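/- Let a mass action network have n species, n reactions and rank Γ = n−1. Then: (i) for every κ ∈ ℝ^n_+ and K ∈ ℝ, the set of nondegenerate equilibria in E_κ ∩ S_K has at most n elements; (ii) if all stoichiometric classes {x ∈ ℝ^n_{≥0} : Zx = K} are bounded, then this set has at most 2 elements. -/

import Mathlib

open Matrix

noncomputable section

/-- Entrywise power of a vector by a real exponent matrix:
`(powVec M x) i = ∏ j, (x j) ^ (M i j)` (real powers). -/
def powVec {k l : ℕ} (M : Matrix (Fin k) (Fin l) ℝ) (x : Fin l → ℝ) : Fin k → ℝ :=
  fun i => ∏ j, x j ^ M i j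

/-- Cast an integer matrix to a real matrix. -/
def mR {a b : ℕ} (M : Matrix (Fin a) (Fin b) ℤ) : Matrix (Fin a) (Fin b) ℝ :=
  M.map fun t => (t : ℝ)

/-- The (open) positive orthant. -/
def posOrth (k : ℕ) : Set (Fin k → ℝ) :=
  {x | ∀ i, 0 < x i}

/-- The mass action vector field `g_κ(x) = Γ (κ ∘ x^A)`. -/
def massAction {n m : ℕ} (Γ : Matrix (Fin n) (Fin m) ℤ) (A : Matrix (Fin m) (Fin n) ℤ)
    (κ : Fin m → ℝ) (x : Fin n → ℝ) : Fin n → ℝ :=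
  (mR Γ).mulVec (κ * powVec (mR A) x)

/-- The positive equilibrium set `E_κ`. -/
def Eset {n m : ℕ} (Γ : Matrix (Fin n) (Fin m) ℤ) (A : Matrix (Fin m) (Fin n) ℤ)
    (κ : Fin m → ℝ) : Set (Fin n → ℝ) :=
  {x | (∀ i, 0 < x i) ∧ massAction Γ A κ x = 0}

/-- The Jacobian matrix `Γ D_{κ∘x^A} A D_{1/x}` of `g_κ` at `x`. -/
def jacMat {n m : ℕ} (Γ : Matrix (Fin n) (Fin m) ℤ) (A : Matrix (Fin m) (Fin n) ℤ)
    (κ : Fin m → ℝ) (x : Fin n → ℝ) : Matrix (Fin n) (Fin n) ℝ :=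
  mR Γ * Matrix.diagonal (κ * powVec (mR A) x) * mR A * Matrix.diagonal (fun i => (x i)⁻¹)

/-- Nondegeneracy of an equilibrium: `ker J_{g_κ}(x) ∩ im Γ = {0}`. -/
def nondegAt {n m : ℕ} (Γ : Matrix (Fin n) (Fin m) ℤ) (A : Matrix (Fin m) (Fin n) ℤ)
    (κ : Fin m → ℝ) (x : Fin n → ℝ) : Prop :=
  ∀ z : Fin n → ℝ, (jacMat Γ A κ x).mulVec z = 0 → (∃ v, (mR Γ).mulVec v = z) → z = 0

/-- Strong degeneracy of the network: every positive equilibrium has Jacobian of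
rank less than `rank Γ`, for every choice of rate constants. -/
def stronglyDegenerate {n m : ℕ} (Γ : Matrix (Fin n) (Fin m) ℤ)
    (A : Matrix (Fin m) (Fin n) ℤ) : Prop :=
  ∀ κ ∈ posOrth m, ∀ x ∈ Eset Γ A κ, (jacMat Γ A κ x).rank < (mR Γ).rank

/-- Dynamically nontrivial: the positive flux cone `ker Γ ∩ ℝ^m_+` is nonempty. -/
def dynNontrivial {n m : ℕ} (Γ : Matrix (Fin n) (Fin m) ℤ) : Prop :=
  ∃ v : Fin m → ℝ, (mR Γ).mulVec v = 0 ∧ ∀ j, 0 < v j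

/-- `ker Γ` factors over the partition of `{1,…,m}` given by the fibres of `blk`. -/
def factorsOver {n m p : ℕ} (Γ : Matrix (Fin n) (Fin m) ℤ) (blk : Fin m → Fin p) : Prop :=
  ∀ v : Fin m → ℝ, (mR Γ).mulVec v = 0 →
    ∀ i : Fin p, (mR Γ).mulVec (fun j => if blk j = i then v j else 0) = 0

/-- The matrix `[A | 1_P]`. -/
def srcMat {n m p : ℕ} (A : Matrix (Fin m) (Fin n) ℤ) (blk : Fin m → Fin p) :
    Matrix (Fin m) (Fin (n + p)) ℝ :=
  Matrix.of fun j => Fin.append (fun k => (A j k : ℝ)) (fun i => if blk j = i then 1 else 0)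

/-- The first `n` rows of an `(n+p)×k` matrix. -/
def topRows (n p : ℕ) {k : ℕ} (M : Matrix (Fin (n + p)) (Fin k) ℝ) :
    Matrix (Fin n) (Fin k) ℝ :=
  Matrix.of fun i j => M (Fin.castAdd p i) j

/-- The flux-cone parameterisation `(1_P λ) ∘ h(α)`. -/
def fluxParam {m p d : ℕ} (blk : Fin m → Fin p) (h : (Fin d → ℝ) → (Fin m → ℝ))
    (lam : Fin p → ℝ) (α : Fin d → ℝ) : Fin m → ℝ :=
  fun j => lam (blk j) * h α j

/-- Admissible cross-section parameterisation of the positive flux cone: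
`Y` is an open bounded convex set (an open polytope), `h` is affine and injective,
depends blockwise on the coordinates of `Y`, and `(λ, α) ↦ (1_P λ) ∘ h(α)` is a
bijection from `ℝ^p_+ × Y` onto the positive flux cone. -/
def admissibleH {n m p d : ℕ} (Γ : Matrix (Fin n) (Fin m) ℤ) (blk : Fin m → Fin p)
    (Y : Set (Fin d → ℝ)) (h : (Fin d → ℝ) → (Fin m → ℝ)) : Prop :=
  IsOpen Y ∧ Convex ℝ Y ∧ Bornology.IsBounded Y ∧ Y.Nonempty ∧
  (∃ (L : (Fin d → ℝ) →ₗ[ℝ] (Fin m → ℝ)) (c : Fin m → ℝ), ∀ α, h α = L α + c) ∧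
  (∃ bY : Fin d → Fin p, ∀ (α α' : Fin d → ℝ) (j : Fin m),
      (∀ t, bY t = blk j → α t = α' t) → h α j = h α' j) ∧
  (∀ (lam : Fin p → ℝ) (α : Fin d → ℝ), (∀ i, 0 < lam i) → α ∈ Y →
      (mR Γ).mulVec (fluxParam blk h lam α) = 0 ∧ ∀ j, 0 < fluxParam blk h lam α j) ∧
  (∀ v : Fin m → ℝ, (mR Γ).mulVec v = 0 → (∀ j, 0 < v j) →
      ∃ (lam : Fin p → ℝ) (α : Fin d → ℝ), (∀ i, 0 < lam i) ∧ α ∈ Y ∧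
        v = fluxParam blk h lam α) ∧
  (∀ (lam lam' : Fin p → ℝ) (α α' : Fin d → ℝ), (∀ i, 0 < lam i) → (∀ i, 0 < lam' i) →
      α ∈ Y → α' ∈ Y → fluxParam blk h lam α = fluxParam blk h lam' α' →
      lam = lam' ∧ α = α')

/-- The solvability variety `A_κ = {α ∈ Y : h(α)^W = κ^W}`. -/
def Aset {m d w : ℕ} (W : Matrix (Fin w) (Fin m) ℝ) (Y : Set (Fin d → ℝ))
    (h : (Fin d → ℝ) → (Fin m → ℝ)) (κ : Fin m → ℝ) : Set (Fin d → ℝ) :=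
  {α ∈ Y | powVec W (h α) = powVec W κ}

/-- The rows of `W` form a basis of `ker [A|1_P]ᵀ`. -/
def isSolvabilityMatrix {n m p w : ℕ} (A : Matrix (Fin m) (Fin n) ℤ) (blk : Fin m → Fin p)
    (W : Matrix (Fin w) (Fin m) ℝ) : Prop :=
  W * srcMat A blk = 0 ∧ W.rank = w ∧ w + (srcMat A blk).rank = m

/-- The columns of `Q` form a basis of `ker [A|1_P]`. -/
def isKernelMatrix {n m p q : ℕ} (A : Matrix (Fin m) (Fin n) ℤ) (blk : Fin m → Fin p)
    (Q : Matrix (Fin (n + p)) (Fin q) ℝ) : Prop :=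
  srcMat A blk * Q = 0 ∧ Q.rank = q ∧ (srcMat A blk).rank + q = n + p

/-- `G` is a generalised inverse of `[A|1_P]`. -/
def isGenInv {n m p : ℕ} (A : Matrix (Fin m) (Fin n) ℤ) (blk : Fin m → Fin p)
    (G : Matrix (Fin (n + p)) (Fin m) ℝ) : Prop :=
  srcMat A blk * G * srcMat A blk = srcMat A blk

/-- The parameterising map `F_κ(α,μ) = (h(α)/κ)^Ĝ ∘ μ^Q̂`. -/
def Fmap {n m p d q : ℕ} (G : Matrix (Fin (n + p)) (Fin m) ℝ)
    (Q : Matrix (Fin (n + p)) (Fin q) ℝ)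
    (h : (Fin d → ℝ) → (Fin m → ℝ)) (κ : Fin m → ℝ) :
    (Fin d → ℝ) × (Fin q → ℝ) → (Fin n → ℝ) :=
  fun z => powVec (topRows n p G) (h z.1 / κ) * powVec (topRows n p Q) z.2


/-- Rolle counting: if all zeros of `f'` lie in `B`, then `f` has at most `B.card + 1` zeros. -/
lemma rolle_count (f f' : ℝ → ℝ) (hf : ∀ t, HasDerivAt f (f' t) t) (B : Finset ℝ)
    (hB : ∀ t, f' t = 0 → t ∈ B) (Z : Finset ℝ) (hZ : ∀ t ∈ Z, f t = 0) :
    Z.card ≤ B.card + 1 := by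
  apply Finset.card_le_of_interleaved
  intro x hx y hy hxy _
  obtain ⟨c, hc, hc0⟩ := exists_hasDerivAt_eq_zero hxy
    (fun t _ => (hf t).continuousAt.continuousWithinAt) ((hZ x hx).trans (hZ y hy).symm)
    (fun t _ => hf t)
  exact ⟨c, hB c hc0, hc.1, hc.2⟩

lemma expsum_hasDeriv {ι : Type*} (s : Finset ι) (a q : ι → ℝ) (C t : ℝ) :
    HasDerivAt (fun t => C + ∑ i ∈ s, a i * Real.exp (q i * t))
      (∑ i ∈ s, a i * q i * Real.exp (q i * t)) t := by
  apply HasDerivAt.const_add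
  apply HasDerivAt.fun_sum
  intro i _
  have h0 : HasDerivAt (fun t : ℝ => q i * t) (q i * 1) t := (hasDerivAt_id' t).const_mul (q i)
  have h : HasDerivAt (fun t : ℝ => a i * Real.exp (q i * t))
      (a i * (Real.exp (q i * t) * (q i * 1))) t := h0.exp.const_mul (a i)
  have he : a i * q i * Real.exp (q i * t) = a i * (Real.exp (q i * t) * (q i * 1)) := by ring
  rw [he]
  exact h

/-- A finite exponential sum which is not identically zero has fewer zeros than terms. -/
lemma expsum_zeros {ι : Type*} [DecidableEq ι] (s : Finset ι) :
    ∀ (a q : ι → ℝ), (∃ t, ∑ i ∈ s, a i * Real.exp (q i * t) ≠ 0) →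
      ∃ B : Finset ℝ, B.card < s.card ∧
        ∀ t, ∑ i ∈ s, a i * Real.exp (q i * t) = 0 → t ∈ B := by
  induction s using Finset.induction_on with
  | empty => intro a q h; simp at h
  | insert j s hj ih =>
    intro a q ⟨t0, ht0⟩
    have key : ∀ t, ∑ i ∈ insert j s, a i * Real.exp (q i * t)
        = Real.exp (q j * t) * (a j + ∑ i ∈ s, a i * Real.exp ((q i - q j) * t)) := by
      intro t
      rw [Finset.sum_insert hj, mul_add, Finset.mul_sum]
      congr 1
      · ring
      · refine Finset.sum_congr rfl fun i _ => ?_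
        rw [mul_left_comm, ← Real.exp_add]
        congr 2; ring
    have key0 : ∀ t, ∑ i ∈ insert j s, a i * Real.exp (q i * t) = 0 ↔
        (a j + ∑ i ∈ s, a i * Real.exp ((q i - q j) * t)) = 0 := by
      intro t
      rw [key, mul_eq_zero]
      simp [Real.exp_ne_zero]
    simp only [key0, ne_eq] at ht0 ⊢
    have hd := fun t => expsum_hasDeriv s a (fun i => q i - q j) (a j) t
    by_cases h : ∃ t, ∑ i ∈ s, (a i * (q i - q j)) * Real.exp ((q i - q j) * t) ≠ 0
    · obtain ⟨B, hBc, hB⟩ := ih (fun i => a i * (q i - q j)) (fun i => q i - q j) h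
      have hcount := rolle_count _ _ hd B hB
      have hfin : {t | a j + ∑ i ∈ s, a i * Real.exp ((q i - q j) * t) = 0}.Finite := by
        by_contra hinf
        obtain ⟨Z, hZ, hZc⟩ := Set.Infinite.exists_subset_card_eq hinf (B.card + 2)
        have := hcount Z (fun t ht => hZ ht)
        omega
      refine ⟨hfin.toFinset, ?_, fun t ht => by simpa using ht⟩
      have := hcount hfin.toFinset (fun t ht => by simpa using ht)
      rw [Finset.card_insert_of_notMem hj]
      omega
    · push Not at h
      refine ⟨∅, by simp, fun t ht => ?_⟩
      exfalso
      apply ht0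
      rw [← ht]
      exact is_const_of_deriv_eq_zero (fun t => (hd t).differentiableAt)
        (fun t => (hd t).deriv.trans (h t)) t0 t

lemma log_powVec {n : ℕ} (A : Matrix (Fin n) (Fin n) ℝ) (x : Fin n → ℝ) (hx : ∀ i, 0 < x i)
    (i : Fin n) : Real.log (powVec A x i) = (A.mulVec (fun j => Real.log (x j))) i := by
  unfold powVec
  rw [Real.log_prod (fun j _ => (Real.rpow_pos_of_pos (hx j) _).ne')]
  exact Finset.sum_congr rfl fun j _ => Real.log_rpow (hx j) _

lemma powVec_pos {n : ℕ} (A : Matrix (Fin n) (Fin n) ℝ) (x : Fin n → ℝ) (hx : ∀ i, 0 < x i)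
    (i : Fin n) : 0 < powVec A x i :=
  Finset.prod_pos fun j _ => Real.rpow_pos_of_pos (hx j) _

/-- A vector orthogonal to the left kernel is in the image. -/
lemma mem_range_of_dot {n : ℕ} (G : Matrix (Fin n) (Fin n) ℝ) (hr : G.rank + 1 = n)
    (z : Fin n → ℝ) (hz : Matrix.vecMul z G = 0) (hz0 : z ≠ 0) (w : Fin n → ℝ)
    (hw : z ⬝ᵥ w = 0) : ∃ v, G.mulVec v = w := by
  let L : (Fin n → ℝ) →ₗ[ℝ] ℝ := dotProductBilin ℝ ℝ z
  have hL : ∀ u, L u = z ⬝ᵥ u := fun u => rfl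
  have hle : LinearMap.range G.mulVecLin ≤ LinearMap.ker L := by
    rintro _ ⟨v, rfl⟩
    rw [LinearMap.mem_ker, hL, Matrix.mulVecLin_apply, Matrix.dotProduct_mulVec, hz,
      zero_dotProduct]
  have hLs : LinearMap.range L = ⊤ := by
    apply LinearMap.range_eq_top.2
    apply LinearMap.surjective
    intro h
    apply hz0
    have := congrArg (fun M => M z) h
    simpa [hL] using this
  have h1 := LinearMap.finrank_range_add_finrank_ker L
  rw [hLs, finrank_top] at h1
  simp at h1
  have heq : LinearMap.range G.mulVecLin = LinearMap.ker L := by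
    apply Submodule.eq_of_le_of_finrank_eq hle
    unfold Matrix.rank at hr
    omega
  have : w ∈ LinearMap.range G.mulVecLin := by
    rw [heq, LinearMap.mem_ker, hL, hw]
  exact this

/-- `ker Γ` is one dimensional. -/
lemma ker_scalar {n : ℕ} (G : Matrix (Fin n) (Fin n) ℝ) (hr : G.rank + 1 = n)
    (u v : Fin n → ℝ) (hu : G.mulVec u = 0) (hv : G.mulVec v = 0) (hu0 : u ≠ 0) :
    ∃ c : ℝ, v = c • u := by
  have h1 := LinearMap.finrank_range_add_finrank_ker G.mulVecLin
  unfold Matrix.rank at hr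
  simp at h1
  have h2 : Module.finrank ℝ (LinearMap.ker G.mulVecLin) = 1 := by omega
  have hu' : (⟨u, hu⟩ : LinearMap.ker G.mulVecLin) ≠ 0 := by
    intro h; exact hu0 (congrArg Subtype.val h)
  obtain ⟨c, hc⟩ := (finrank_eq_one_iff_of_nonzero' _ hu').1 h2 ⟨v, hv⟩
  exact ⟨c, (congrArg Subtype.val hc).symm⟩

/-- `ker J` is at most one dimensional at a nondegenerate point. -/
lemma ker_jac {n : ℕ} (G J : Matrix (Fin n) (Fin n) ℝ) (hr : G.rank + 1 = n)
    (hJ : ∀ z : Fin n → ℝ, J.mulVec z = 0 → (∃ v, G.mulVec v = z) → z = 0) :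
    ∃ w0 : Fin n → ℝ, J.mulVec w0 = 0 ∧ ∀ w, J.mulVec w = 0 → ∃ c : ℝ, w = c • w0 := by
  have hdis : Disjoint (LinearMap.ker J.mulVecLin) (LinearMap.range G.mulVecLin) := by
    rw [Submodule.disjoint_def]
    intro w hw hw'
    exact hJ w hw hw'
  have h1 := Submodule.finrank_add_finrank_le_of_disjoint hdis
  unfold Matrix.rank at hr
  simp at h1
  have h2 : Module.finrank ℝ (LinearMap.ker J.mulVecLin) ≤ 1 := by omega
  obtain ⟨⟨w0, hw0⟩, h⟩ := finrank_le_one_iff.1 h2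
  refine ⟨w0, hw0, fun w hw => ?_⟩
  obtain ⟨c, hc⟩ := h ⟨w, hw⟩
  exact ⟨c, (congrArg Subtype.val hc).symm⟩

/-- Log-differences of equilibria give kernel vectors of the Jacobian. -/
lemma logdiff_ker {n : ℕ} (Γ A : Matrix (Fin n) (Fin n) ℤ) (hr : (mR Γ).rank + 1 = n)
    (κ : Fin n → ℝ) (hκ : ∀ i, 0 < κ i) (x y : Fin n → ℝ)
    (hx : x ∈ Eset Γ A κ) (hy : y ∈ Eset Γ A κ) :
    (jacMat Γ A κ x).mulVec (fun i => x i * (Real.log (y i) - Real.log (x i))) = 0 := by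
  have hn : 0 < n := by omega
  have hpx : ∀ i, 0 < (κ * powVec (mR A) x) i := fun i =>
    mul_pos (hκ i) (powVec_pos _ _ hx.1 i)
  have hpy : ∀ i, 0 < (κ * powVec (mR A) y) i := fun i =>
    mul_pos (hκ i) (powVec_pos _ _ hy.1 i)
  obtain ⟨c, hc⟩ := ker_scalar (mR Γ) hr _ _ hx.2 hy.2
    (fun h => (hpx ⟨0, hn⟩).ne' (congrFun h _))
  have hc0 : 0 < c := by
    have h := hpy ⟨0, hn⟩
    rw [hc] at h
    exact (pos_iff_pos_of_mul_pos h).2 (hpx ⟨0, hn⟩)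
  have hD : (Matrix.diagonal (fun i => (x i)⁻¹)).mulVec
      (fun i => x i * (Real.log (y i) - Real.log (x i)))
      = (fun i => Real.log (y i)) - (fun i => Real.log (x i)) := by
    funext i
    rw [Matrix.mulVec_diagonal]
    simp only [Pi.sub_apply]
    rw [inv_mul_cancel_left₀ (hx.1 i).ne']
  have hAm : (mR A).mulVec ((fun i => Real.log (y i)) - (fun i => Real.log (x i)))
      = fun _ => Real.log c := by
    rw [Matrix.mulVec_sub]
    funext i
    rw [Pi.sub_apply, ← log_powVec _ _ hy.1, ← log_powVec _ _ hx.1]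
    have h : powVec (mR A) y i = c * powVec (mR A) x i := by
      have := congrFun hc i
      simp only [Pi.mul_apply, Pi.smul_apply, smul_eq_mul] at this
      apply mul_left_cancel₀ (hκ i).ne'
      rw [this]; ring
    rw [h, Real.log_mul hc0.ne' (powVec_pos _ _ hx.1 i).ne']
    ring
  unfold jacMat
  rw [← Matrix.mulVec_mulVec, hD, ← Matrix.mulVec_mulVec, hAm, ← Matrix.mulVec_mulVec]
  have : (Matrix.diagonal (κ * powVec (mR A) x)).mulVec (fun _ => Real.log c)
      = Real.log c • (κ * powVec (mR A) x) := by
    funext i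
    rw [Matrix.mulVec_diagonal, Pi.smul_apply, smul_eq_mul, mul_comm]
  rw [this, Matrix.mulVec_smul]
  have h0 : (mR Γ).mulVec (κ * powVec (mR A) x) = 0 := hx.2
  rw [h0, smul_zero]

/-- Reduction to one-variable exponential sums. -/
lemma reduction {n : ℕ} (Γ A : Matrix (Fin n) (Fin n) ℤ) (hr : (mR Γ).rank + 1 = n)
    (z : Fin n → ℝ) (hz : Matrix.vecMul z (mR Γ) = 0) (hz0 : z ≠ 0)
    (κ : Fin n → ℝ) (hκ : ∀ i, 0 < κ i) (K : ℝ) (T : Finset (Fin n → ℝ))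
    (hT : (T : Set (Fin n → ℝ)) ⊆ {x | x ∈ Eset Γ A κ ∧ z ⬝ᵥ x = K ∧ nondegAt Γ A κ x}) :
    T.card ≤ 1 ∨ ∃ (x q : Fin n → ℝ) (Z : Finset ℝ), (∀ i, 0 < x i) ∧ T.card = Z.card ∧
      (∑ i, z i * x i * q i ≠ 0) ∧
      ∀ t ∈ Z, -K + ∑ i, z i * x i * Real.exp (q i * t) = 0 := by
  rcases T.eq_empty_or_nonempty with h | ⟨x, hxT⟩
  · left; simp [h]
  obtain ⟨hx, hxK, hxn⟩ := hT hxT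
  obtain ⟨w0, hw0, hw⟩ := ker_jac (mR Γ) (jacMat Γ A κ x) hr hxn
  have hex : ∀ y ∈ T, ∃ c : ℝ, ∀ i, y i = x i * Real.exp (w0 i / x i * c) := by
    intro y hyT
    obtain ⟨hy, -, -⟩ := hT hyT
    obtain ⟨c, hc⟩ := hw _ (logdiff_ker Γ A hr κ hκ x y hx hy)
    refine ⟨c, fun i => ?_⟩
    have h := congrFun hc i
    simp only [Pi.smul_apply, smul_eq_mul] at h
    have hxi := hx.1 i
    have h2 : w0 i / x i * c = Real.log (y i) - Real.log (x i) := by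
      field_simp
      linarith
    rw [h2, Real.exp_sub, Real.exp_log (hy.1 i), Real.exp_log hxi]
    field_simp
  by_cases hd : z ⬝ᵥ w0 = 0
  · left
    have : w0 = 0 := hxn w0 hw0 (mem_range_of_dot _ hr z hz hz0 w0 hd)
    have hall : ∀ y ∈ T, y = x := by
      intro y hyT
      obtain ⟨c, hc⟩ := hex y hyT
      funext i
      rw [hc i, this]; simp
    exact Finset.card_le_one.2 fun a ha b hb => (hall a ha).trans (hall b hb).symm
  · right
    choose! c hc using hex
    refine ⟨x, fun i => w0 i / x i, T.image c, hx.1, ?_, ?_, ?_⟩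
    · symm
      apply Finset.card_image_of_injOn
      intro a ha b hb hab
      funext i
      rw [hc a ha i, hc b hb i, hab]
    · convert hd using 1
      unfold dotProduct
      refine Finset.sum_congr rfl fun i _ => ?_
      have := (hx.1 i).ne'
      field_simp
    · intro t ht
      obtain ⟨y, hyT, rfl⟩ := Finset.mem_image.1 ht
      obtain ⟨hy, hyK, -⟩ := hT hyT
      rw [← hyK]
      unfold dotProduct
      rw [neg_add_eq_zero]
      refine Finset.sum_congr rfl fun i _ => ?_
      rw [mul_assoc, ← hc y hyT i]

lemma strictMono_expsum {n : ℕ} (a q : Fin n → ℝ) (ha : ∀ i, 0 < a i) (hq : ∃ i, q i ≠ 0) :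
    StrictMono (fun t => ∑ i, a i * q i * Real.exp (q i * t)) := by
  intro s t hst
  have hlt : ∀ i, q i ≠ 0 → a i * q i * Real.exp (q i * s) < a i * q i * Real.exp (q i * t) := by
    intro i hi
    rcases lt_or_gt_of_ne hi with h | h
    · apply mul_lt_mul_of_neg_left _ (mul_neg_of_pos_of_neg (ha i) h)
      exact Real.exp_lt_exp.2 (mul_lt_mul_of_neg_left hst h)
    · apply mul_lt_mul_of_pos_left _ (mul_pos (ha i) h)
      exact Real.exp_lt_exp.2 (mul_lt_mul_of_pos_left hst h)
  apply Finset.sum_lt_sum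
  · intro i _
    by_cases hi : q i = 0
    · simp [hi]
    · exact (hlt i hi).le
  · obtain ⟨i, hi⟩ := hq
    exact ⟨i, Finset.mem_univ _, hlt i hi⟩

/-- Boundedness forces no nonzero nonnegative vector orthogonal to `z`. -/
lemma no_ray {n : ℕ} (z : Fin n → ℝ)
    (hb : Bornology.IsBounded {x : Fin n → ℝ | (∀ i, 0 ≤ x i) ∧ z ⬝ᵥ x = 0})
    (u : Fin n → ℝ) (hu : ∀ i, 0 ≤ u i) (hzu : z ⬝ᵥ u = 0) : u = 0 := by
  obtain ⟨R, hR⟩ := hb.exists_norm_le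
  by_contra hne
  have hpos : 0 < ‖u‖ := norm_pos_iff.2 hne
  have hR0 : 0 ≤ R := (norm_nonneg _).trans (hR 0 (by simp))
  have h := hR (((R + 1) / ‖u‖) • u) ⟨fun i => by
    have := hu i
    simp only [Pi.smul_apply, smul_eq_mul]; positivity, by
    rw [dotProduct_smul, hzu, smul_zero]⟩
  rw [norm_smul, Real.norm_of_nonneg (by positivity), div_mul_cancel₀ _ hpos.ne'] at h
  linarith

lemma same_sign {n : ℕ} (z : Fin n → ℝ)
    (hb : Bornology.IsBounded {x : Fin n → ℝ | (∀ i, 0 ≤ x i) ∧ z ⬝ᵥ x = 0}) :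
    (∀ i, 0 < z i) ∨ (∀ i, z i < 0) := by
  by_contra hcon
  push Not at hcon
  obtain ⟨⟨i, hi⟩, ⟨j, hj⟩⟩ := hcon
  by_cases hi0 : z i = 0
  · have := no_ray z hb (Pi.single i 1)
      (fun k => by rw [Pi.single_apply]; split_ifs <;> norm_num) (by simp [hi0])
    simpa using congrFun this i
  have hi' : z i < 0 := lt_of_le_of_ne hi hi0
  have hij : j ≠ i := by rintro rfl; linarith
  have := no_ray z hb (Pi.single i (z j) + Pi.single j (-z i)) (fun k => by
      rw [Pi.add_apply, Pi.single_apply, Pi.single_apply]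
      split_ifs <;> linarith) (by simp [dotProduct_add]; ring)
  have h := congrFun this j
  simp [hij] at h
  exact hi0 h

/-- Corollary `cornnn1`: an `(n,n,n−1)` mass action network has
(i) at most `n` nondegenerate positive equilibria on each stoichiometric class, and
(ii) at most `2` if all stoichiometric classes are bounded. -/
theorem statement13 {n : ℕ}
    (Γ : Matrix (Fin n) (Fin n) ℤ) (A : Matrix (Fin n) (Fin n) ℤ)
    (hA : ∀ i j, 0 ≤ A i j)
    (hrank : (mR Γ).rank + 1 = n)
    (z : Fin n → ℝ) (hz : Matrix.vecMul z (mR Γ) = 0) (hz0 : z ≠ 0) :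
    (∀ κ ∈ posOrth n, ∀ K : ℝ, ∀ T : Finset (Fin n → ℝ),
        ↑T ⊆ {x | x ∈ Eset Γ A κ ∧ z ⬝ᵥ x = K ∧ nondegAt Γ A κ x} → T.card ≤ n) ∧
    ((∀ K : ℝ, Bornology.IsBounded {x : Fin n → ℝ | (∀ i, 0 ≤ x i) ∧ z ⬝ᵥ x = K}) →
      ∀ κ ∈ posOrth n, ∀ K : ℝ, ∀ T : Finset (Fin n → ℝ),
        ↑T ⊆ {x | x ∈ Eset Γ A κ ∧ z ⬝ᵥ x = K ∧ nondegAt Γ A κ x} → T.card ≤ 2) := by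
  have hn : 1 ≤ n := by omega
  refine ⟨?_, ?_⟩
  · intro κ hκ K T hT
    rcases reduction Γ A hrank z hz hz0 κ hκ K T hT with h | ⟨x, q, Z, hx, hcard, hd, hZ⟩
    · omega
    · obtain ⟨B, hBc, hB⟩ := expsum_zeros Finset.univ (fun i => z i * x i * q i) q
        ⟨0, by simpa using hd⟩
      have := rolle_count _ _
        (fun t => expsum_hasDeriv Finset.univ (fun i => z i * x i) q (-K) t) B hB Z hZ
      simp at hBc
      omega
  · intro hb κ hκ K T hT
    rcases reduction Γ A hrank z hz hz0 κ hκ K T hT with h | ⟨x, q, Z, hx, hcard, hd, hZ⟩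
    · omega
    · have hq : ∃ i, q i ≠ 0 := by
        by_contra hcon
        push Not at hcon
        exact hd (by simp [hcon])
      have hinj : Function.Injective
          (fun t => ∑ i, z i * x i * q i * Real.exp (q i * t)) := by
        rcases same_sign z (hb 0) with hs | hs
        · exact (strictMono_expsum (fun i => z i * x i) q
            (fun i => mul_pos (hs i) (hx i)) hq).injective
        · have h := (strictMono_expsum (fun i => -(z i * x i)) q
            (fun i => neg_pos.2 (mul_neg_of_neg_of_pos (hs i) (hx i))) hq).injective
          intro s t hst
          apply h
          simpa [neg_mul, Finset.sum_neg_distrib] using hst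
      have hB : ∃ B : Finset ℝ, B.card ≤ 1 ∧
          ∀ t, ∑ i, z i * x i * q i * Real.exp (q i * t) = 0 → t ∈ B := by
        by_cases h : ∃ t, ∑ i, z i * x i * q i * Real.exp (q i * t) = 0
        · obtain ⟨t0, ht0⟩ := h
          exact ⟨{t0}, by simp, fun t ht => by
            rw [Finset.mem_singleton]; exact hinj (ht.trans ht0.symm)⟩
        · exact ⟨∅, by simp, fun t ht => (h ⟨t, ht⟩).elim⟩
      obtain ⟨B, hBc, hB⟩ := hB
      have := rolle_count _ _
        (fun t => expsum_hasDeriv Finset.univ (fun i => z i * x i) q (-K) t) B hB Z hZ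
      omega

end
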